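/- arXiv:2605.13691 — 2 statements merged into one kernel-verified Lean document; each statement's English description precedes it below -/
import Mathlib

section
/- Let n ≥ 1, let m ≥ 1, let ρ₁, …, ρ_m be n×n complex density matrices (Hermitian, positive semidefinite, trace 1), and let p₁, …, p_m be nonnegative reals with ∑ᵢ pᵢ = 1. With Q₂(ρ) = log(2 / (1 + Tr(ρ²))), one has Q₂(∑ᵢ pᵢ ρᵢ) ≥ ∑ᵢ pᵢ Q₂(ρᵢ). In particular, the averaged accessible information χ₂ = Q₂(∑ᵢ pᵢ ρᵢ) − ∑ᵢ pᵢ Q₂(ρᵢ) is nonnegative. -/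
open Matrix Finset
open scoped ComplexOrder

/-- The averaged accessible information `Q₂(ρ) = log(2 / (1 + Tr ρ²))`. -/
noncomputable def Q2 {n : ℕ} (ρ : Matrix (Fin n) (Fin n) ℂ) : ℝ :=
  Real.log (2 / (1 + ((ρ * ρ).trace).re))

lemma aux_convex : ConvexOn ℝ (Set.Icc (0:ℝ) 1) (fun x => Real.log (1 + x^2)) := by
  have hd : ∀ x : ℝ, HasDerivAt (fun x : ℝ => Real.log (1 + x^2)) (2*x/(1+x^2)) x := by
    intro x
    have h1 : HasDerivAt (fun x : ℝ => 1 + x^2) (2*x) x := by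
      simpa using (hasDerivAt_pow 2 x).const_add 1
    exact h1.log (by positivity)
  apply MonotoneOn.convexOn_of_deriv (convex_Icc 0 1)
  · exact fun x _ => (hd x).continuousAt.continuousWithinAt
  · exact fun x _ => (hd x).differentiableAt.differentiableWithinAt
  · intro x hx y hy hxy
    rw [interior_Icc] at hx hy
    obtain ⟨hx0, hx1⟩ := hx
    obtain ⟨hy0, hy1⟩ := hy
    rw [(hd x).deriv, (hd y).deriv, div_le_div_iff₀ (by positivity) (by positivity)]
    nlinarith [mul_nonneg (sub_nonneg.2 hxy) (sub_nonneg.2 (mul_le_one₀ hx1.le hy0.le hy1.le))]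

lemma aux_tr {n : ℕ} (A : Matrix (Fin n) (Fin n) ℂ) (hA : A.IsHermitian) :
    ((A * A).trace).re = ∑ i, ∑ j, ‖A i j‖^2 := by
  simp only [Matrix.trace, Matrix.diag, Matrix.mul_apply, Complex.re_sum]
  refine Finset.sum_congr rfl fun i _ => Finset.sum_congr rfl fun j _ => ?_
  rw [← hA.apply j i, ← Complex.normSq_eq_norm_sq, Complex.star_def, Complex.mul_conj,
    Complex.ofReal_re]

section
attribute [local instance] Matrix.frobeniusNormedAddCommGroup Matrix.frobeniusNormedSpace

lemma aux_norm {n : ℕ} (A : Matrix (Fin n) (Fin n) ℂ) (hA : A.IsHermitian) :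
    ((A * A).trace).re = ‖A‖^2 := by
  rw [aux_tr A hA, Matrix.frobenius_norm_def, ← Real.sqrt_eq_rpow, Real.sq_sqrt (by positivity)]
  simp

lemma aux_entry {n : ℕ} (A : Matrix (Fin n) (Fin n) ℂ) (hA : A.PosSemidef) (i j : Fin n) :
    ‖A i j‖^2 ≤ (A i i).re * (A j j).re := by
  have h := (hA.submatrix ![i, j]).det_nonneg
  rw [Matrix.det_fin_two] at h
  simp only [Matrix.submatrix_apply, Matrix.cons_val_zero, Matrix.cons_val_one] at h
  have hi : (A i i).im = 0 := Complex.conj_eq_iff_im.1 (hA.1.apply i i)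
  rw [← hA.1.apply j i, Complex.star_def, Complex.mul_conj] at h
  have h2 := (Complex.le_def.1 h).1
  simp [hi] at h2
  rw [← Complex.normSq_eq_norm_sq]
  linarith

lemma aux_le_one {n : ℕ} (A : Matrix (Fin n) (Fin n) ℂ) (hA : A.PosSemidef)
    (ht : A.trace = 1) : ‖A‖ ≤ 1 := by
  have h : ‖A‖^2 ≤ 1 := by
    rw [← aux_norm A hA.1, aux_tr A hA.1]
    have ht' : ∑ i, (A i i).re = 1 := by
      have := congrArg Complex.re ht
      simpa [Matrix.trace, Complex.re_sum] using this
    calc _ ≤ ∑ i, ∑ j, (A i i).re * (A j j).re :=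
          Finset.sum_le_sum fun i _ => Finset.sum_le_sum fun j _ => aux_entry A hA i j
      _ = (∑ i, (A i i).re) * (∑ j, (A j j).re) := (Finset.sum_mul_sum _ _ _ _).symm
      _ = 1 := by rw [ht']; norm_num
  nlinarith [norm_nonneg A]

lemma aux_Q2 {n : ℕ} (A : Matrix (Fin n) (Fin n) ℂ) (hA : A.IsHermitian) :
    Q2 A = Real.log 2 - Real.log (1 + ‖A‖^2) := by
  rw [Q2, aux_norm A hA, Real.log_div (by norm_num) (by positivity)]

lemma aux_main (n : ℕ) (m : ℕ)
    (ρ : Fin m → Matrix (Fin n) (Fin n) ℂ)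
    (hρ : ∀ i, (ρ i).PosSemidef) (hρtr : ∀ i, (ρ i).trace = 1)
    (p : Fin m → ℝ) (hp : ∀ i, 0 ≤ p i) (hps : ∑ i, p i = 1) :
    ∑ i, p i * Q2 (ρ i) ≤ Q2 (∑ i, p i • ρ i) := by
  have hH : (∑ i, p i • ρ i).IsHermitian := by
    rw [Matrix.IsHermitian, Matrix.conjTranspose_sum]
    refine Finset.sum_congr rfl fun i _ => ?_
    rw [Matrix.conjTranspose_smul, (hρ i).1.eq]
    simp
  rw [aux_Q2 _ hH]
  have h1 : ∑ i, p i * Q2 (ρ i) = Real.log 2 - ∑ i, p i * Real.log (1 + ‖ρ i‖^2) := by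
    simp only [aux_Q2 _ (hρ _).1, mul_sub, Finset.sum_sub_distrib]
    rw [← Finset.sum_mul, hps, one_mul]
  rw [h1]
  have h2 := aux_convex.map_sum_le (t := Finset.univ) (w := p) (p := fun i => ‖ρ i‖)
    (fun i _ => hp i) hps (fun i _ => ⟨norm_nonneg _, aux_le_one _ (hρ i) (hρtr i)⟩)
  simp only [smul_eq_mul] at h2
  have h3 : ‖∑ i, p i • ρ i‖ ≤ ∑ i, p i * ‖ρ i‖ := by
    refine (norm_sum_le _ _).trans (Finset.sum_le_sum fun i _ => ?_)
    rw [norm_smul, Real.norm_of_nonneg (hp i)]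
  have h4 : Real.log (1 + ‖∑ i, p i • ρ i‖^2) ≤ Real.log (1 + (∑ i, p i * ‖ρ i‖)^2) := by
    apply Real.log_le_log (by positivity)
    gcongr
  linarith

end

/-- For an ensemble `{pᵢ, ρᵢ}` of `m` density matrices with probabilities `pᵢ`,
`Q₂(∑ᵢ pᵢ ρᵢ) ≥ ∑ᵢ pᵢ Q₂(ρᵢ)`; in particular the averaged accessible
information `χ₂ = Q₂(∑ᵢ pᵢ ρᵢ) − ∑ᵢ pᵢ Q₂(ρᵢ)` is nonnegative. -/
theorem stmt_8 (n : ℕ) (hn : 1 ≤ n) (m : ℕ) (hm : 1 ≤ m)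
    (ρ : Fin m → Matrix (Fin n) (Fin n) ℂ)
    (hρ : ∀ i, (ρ i).PosSemidef) (hρtr : ∀ i, (ρ i).trace = 1)
    (p : Fin m → ℝ) (hp : ∀ i, 0 ≤ p i) (hps : ∑ i, p i = 1) :
    Q2 (∑ i, p i • ρ i) ≥ ∑ i, p i * Q2 (ρ i) ∧
      0 ≤ Q2 (∑ i, p i • ρ i) - ∑ i, p i * Q2 (ρ i) := by
  have h := aux_main n m ρ hρ hρtr p hp hps
  exact ⟨h, sub_nonneg.2 h⟩
end

section
/- Let n ≥ 1 and let ρ₀, ρ₁ be distinct n×n complex density matrices (Hermitian, positive semidefinite, trace 1), and set Δ = ρ₁ − ρ₀. Then 2 Tr(Δ²) (1 + Tr(ρ₀²)) − 4 (Tr(ρ₀ Δ))² > 0. -/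
open Matrix
open scoped ComplexOrder

lemma aux_nonneg {n : ℕ} (H : Matrix (Fin n) (Fin n) ℂ) (hH : H.IsHermitian) :
    0 ≤ ((H * H).trace).re := by
  have h := (Matrix.posSemidef_conjTranspose_mul_self H).trace_nonneg
  rw [hH.eq] at h
  exact (Complex.le_def.1 h).1

lemma aux_pos {n : ℕ} (H : Matrix (Fin n) (Fin n) ℂ) (hH : H.IsHermitian) (h0 : H ≠ 0) :
    0 < ((H * H).trace).re := by
  have h := (Matrix.posSemidef_conjTranspose_mul_self H).trace_nonneg
  have h' : (Hᴴ * H).trace ≠ 0 := fun h => h0 (Matrix.trace_conjTranspose_mul_self_eq_zero_iff.1 h)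
  have h2 := lt_of_le_of_ne h h'.symm
  rw [hH.eq] at h2
  exact (Complex.lt_def.1 h2).1

lemma aux_purity {n : ℕ} (A : Matrix (Fin n) (Fin n) ℂ) (hA : A.PosSemidef)
    (htr : A.trace = 1) : ((A * A).trace).re ≤ 1 := by
  have key : ∀ i j, A i j * A j i ≤ A i i * A j j := by
    intro i j
    have h := (hA.submatrix ![i, j]).det_nonneg
    rw [Matrix.det_fin_two] at h
    simpa using h
  have h : (A * A).trace ≤ A.trace * A.trace := by
    simp only [Matrix.trace, Matrix.diag, Matrix.mul_apply, Finset.sum_mul_sum]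
    exact Finset.sum_le_sum fun i _ => Finset.sum_le_sum fun j _ => key i j
  rw [htr] at h
  simpa using (Complex.le_def.1 h).1

/-- For distinct density matrices `ρ₀ ≠ ρ₁` with `Δ = ρ₁ - ρ₀`, the quantity
`2 Tr(Δ²)(1 + Tr(ρ₀²)) − 4 (Tr(ρ₀Δ))²` is strictly positive. -/
theorem stmt_9 (n : ℕ) (hn : 1 ≤ n) (ρ₀ ρ₁ : Matrix (Fin n) (Fin n) ℂ)
    (h₀ : ρ₀.PosSemidef) (h₀tr : ρ₀.trace = 1)
    (h₁ : ρ₁.PosSemidef) (h₁tr : ρ₁.trace = 1)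
    (hne : ρ₀ ≠ ρ₁) :
    0 < 2 * (((ρ₁ - ρ₀) * (ρ₁ - ρ₀)).trace).re * (1 + ((ρ₀ * ρ₀).trace).re)
        - 4 * (((ρ₀ * (ρ₁ - ρ₀)).trace).re) ^ 2 := by
  have hP := aux_purity ρ₀ h₀ h₀tr
  have hD : (ρ₁ - ρ₀).IsHermitian := h₁.isHermitian.sub h₀.isHermitian
  have hDt : (ρ₁ - ρ₀).trace = 0 := by rw [Matrix.trace_sub, h₀tr, h₁tr, sub_self]
  have hS := aux_pos _ hD (sub_ne_zero.2 hne.symm)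
  generalize ρ₁ - ρ₀ = D at *
  have hnR : (0 : ℝ) < n := by exact_mod_cast hn
  have hM : ∀ s c e : ℝ, (s • ρ₀ - c • D - e • (1 : Matrix (Fin n) (Fin n) ℂ)).IsHermitian := by
    intro s c e
    have h := h₀.isHermitian.eq
    have h' := hD.eq
    simp [Matrix.IsHermitian, Matrix.conjTranspose_sub, Matrix.conjTranspose_smul, h, h']
  have hQ : ∀ s c e : ℝ, 0 ≤ s ^ 2 * ((ρ₀ * ρ₀).trace).re - 2 * s * c * ((ρ₀ * D).trace).re
      + c ^ 2 * ((D * D).trace).re - 2 * s * e + e ^ 2 * n := by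
    intro s c e
    have h := aux_nonneg _ (hM s c e)
    simp [sub_mul, mul_sub, Matrix.trace_sub, Matrix.trace_smul, h₀tr, hDt,
      Matrix.trace_mul_comm D ρ₀] at h
    linarith
  set S := ((D * D).trace).re
  set c := ((ρ₀ * D).trace).re
  set P := ((ρ₀ * ρ₀).trace).re
  have h := hQ S c (S / n)
  have h2 : 0 ≤ S * (S * (P - 1 / n) - c ^ 2) := by
    refine h.trans_eq ?_
    field_simp
    ring
  have h3 := nonneg_of_mul_nonneg_right h2 hS
  have h4 : 0 < S * (1 / n) := by positivity
  nlinarith [mul_nonneg hS.le (sub_nonneg.2 hP)]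
end
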